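/- arXiv:2308.13471 — 2 statements merged into one kernel-verified Lean document; each statement's English description precedes it below -/
import Mathlib

section
/- Let E and F be finite-dimensional real inner product spaces, A : E → F a linear map, b ∈ F, and M : E → ℝ a convex function. Define T(x) = ½‖A x − b‖² + M(x). If x* is a minimizer of T on E, then for every x ∈ E, T(x) − T(x*) ≥ ½‖A(x − x*)‖². -/
/-- A least-squares term plus a convex function is convex with modulus `½‖A(x - y)‖²`. -/
theorem ConvexOn.half_norm_sq_sub_add_le
    {E F : Type*} [AddCommGroup E] [Module ℝ E] [NormedAddCommGroup F] [InnerProductSpace ℝ F]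
    (A : E →ₗ[ℝ] F) (b : F) {M : E → ℝ} (hM : ConvexOn ℝ Set.univ M) (x y : E)
    {t : ℝ} (ht₀ : 0 ≤ t) (ht₁ : t ≤ 1) :
    (1 / 2) * ‖A ((1 - t) • y + t • x) - b‖ ^ 2 + M ((1 - t) • y + t • x) ≤
      (1 - t) * ((1 / 2) * ‖A y - b‖ ^ 2 + M y) + t * ((1 / 2) * ‖A x - b‖ ^ 2 + M x)
        - t * (1 - t) * ((1 / 2) * ‖A (x - y)‖ ^ 2) := by
  have hconv := hM.2 (Set.mem_univ y) (Set.mem_univ x) (sub_nonneg.2 ht₁) ht₀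
    (sub_add_cancel 1 t)
  simp only [smul_eq_mul] at hconv
  have hcomb : A ((1 - t) • y + t • x) - b = (A y - b) + t • A (x - y) := by
    simp only [map_add, map_smul, map_sub]
    module
  have hx : A x - b = (A y - b) + A (x - y) := by
    rw [map_sub]
    abel
  rw [hcomb, hx, norm_add_sq_real, norm_add_sq_real, inner_smul_right, norm_smul, mul_pow,
    Real.norm_eq_abs, sq_abs]
  linarith

/-- quadratic growth at a minimizer of `x ↦ ½‖Ax − b‖² + M(x)`
with `M` convex. -/
theorem quadratic_growth_at_minimizer
    {E F : Type*} [NormedAddCommGroup E] [InnerProductSpace ℝ E] [FiniteDimensional ℝ E]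
    [NormedAddCommGroup F] [InnerProductSpace ℝ F] [FiniteDimensional ℝ F]
    (A : E →ₗ[ℝ] F) (b : F) (M : E → ℝ) (hM : ConvexOn ℝ Set.univ M)
    (T : E → ℝ) (hT : ∀ x, T x = (1 / 2) * ‖A x - b‖ ^ 2 + M x)
    (xstar : E) (hmin : ∀ x, T xstar ≤ T x) :
    ∀ x, T x - T xstar ≥ (1 / 2) * ‖A (x - xstar)‖ ^ 2 := by
  intro x
  set V := (1 / 2) * ‖A (x - xstar)‖ ^ 2 with hV
  have key : ∀ t : ℝ, 0 < t → t ≤ 1 → (1 - t) * V ≤ T x - T xstar := by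
    intro t ht₀ ht₁
    have hle := (hmin ((1 - t) • xstar + t • x)).trans
      ((hT _).trans_le (hM.half_norm_sq_sub_add_le A b x xstar ht₀.le ht₁))
    rw [← hT, ← hT, ← hV] at hle
    refine le_of_mul_le_mul_left ?_ ht₀
    linarith
  have hlim : Filter.Tendsto (fun t : ℝ => (1 - t) * V) (nhdsWithin 0 (Set.Ioi 0)) (nhds V) := by
    have hcont : Continuous fun t : ℝ => (1 - t) * V := by fun_prop
    simpa using (hcont.tendsto 0).mono_left nhdsWithin_le_nhds
  refine le_of_tendsto hlim ?_
  filter_upwards [Ioc_mem_nhdsGT (zero_lt_one' ℝ)] with t ht using key t ht.1 ht.2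
end

section
/- (Proximal forward–backward descent) Let E be a finite-dimensional real inner product space, f2 : E → ℝ continuously differentiable with gradient ∇f2 Lipschitz continuous with constant L ≥ 0, C ⊆ E a nonempty closed set, and f1 : E → ℝ a lower semicontinuous function bounded below on C. Let τ > 0, let x ∈ C, and let x⁺ ∈ C be a minimizer over C of z ↦ f1(z) + (1/(2τ))‖z − (x − τ∇f2(x))‖². Then ½(1/τ − L)‖x⁺ − x‖² ≤ (f1(x) + f2(x)) − (f1(x⁺) + f2(x⁺)). -/
open scoped InnerProductSpace in
/-- Descent lemma: a function whose gradient is `L`-Lipschitz lies below its quadratic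
upper model. -/
theorem le_add_inner_gradient_add_sq_of_lipschitz
    {E : Type*} [NormedAddCommGroup E] [InnerProductSpace ℝ E] [CompleteSpace E]
    {f : E → ℝ} {L : ℝ} (hf : Differentiable ℝ f)
    (hLip : ∀ x y, ‖gradient f x - gradient f y‖ ≤ L * ‖x - y‖) (x v : E) :
    f (x + v) ≤ f x + ⟪gradient f x, v⟫_ℝ + L / 2 * ‖v‖ ^ 2 := by
  have hderiv (t : ℝ) :
      HasDerivAt (fun s : ℝ => f (x + s • v)) ⟪gradient f (x + t • v), v⟫_ℝ t := by
    have hline : HasDerivAt (fun s : ℝ => x + s • v) v t := by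
      simpa using ((hasDerivAt_id t).smul_const v).const_add x
    simpa [Function.comp_def] using
      (hf (x + t • v)).hasGradientAt.hasFDerivAt.comp_hasDerivAt t hline
  have hmodel (t : ℝ) :
      HasDerivAt (fun s : ℝ => f x + s * ⟪gradient f x, v⟫_ℝ + L / 2 * ‖v‖ ^ 2 * s ^ 2)
        (⟪gradient f x, v⟫_ℝ + L * ‖v‖ ^ 2 * t) t := by
    refine ((((hasDerivAt_id t).mul_const ⟪gradient f x, v⟫_ℝ).const_add (f x)).add
      ((hasDerivAt_pow 2 t).const_mul (L / 2 * ‖v‖ ^ 2))).congr_deriv ?_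
    push_cast
    ring
  have hle := image_le_of_deriv_right_le_deriv_boundary (a := 0) (b := 1)
    (fun t _ => (hderiv t).continuousAt.continuousWithinAt)
    (fun t _ => (hderiv t).hasDerivWithinAt) (by simp)
    (fun t _ => (hmodel t).continuousAt.continuousWithinAt)
    (fun t _ => (hmodel t).hasDerivWithinAt)
    (fun t ht => by
      have hgrad := hLip (x + t • v) x
      rw [add_sub_cancel_left, norm_smul, Real.norm_of_nonneg ht.1] at hgrad
      calc ⟪gradient f (x + t • v), v⟫_ℝ
          = ⟪gradient f x, v⟫_ℝ + ⟪gradient f (x + t • v) - gradient f x, v⟫_ℝ := by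
            rw [inner_sub_left]; ring
        _ ≤ ⟪gradient f x, v⟫_ℝ + L * (t * ‖v‖) * ‖v‖ := by
            gcongr
            exact (real_inner_le_norm _ _).trans (by gcongr)
        _ = ⟪gradient f x, v⟫_ℝ + L * ‖v‖ ^ 2 * t := by ring)
    (Set.right_mem_Icc.mpr zero_le_one)
  simpa using hle


/-- proximal forward–backward descent inequality. -/
theorem proximal_forward_backward_descent
    {E : Type*} [NormedAddCommGroup E] [InnerProductSpace ℝ E] [FiniteDimensional ℝ E]
    (f1 f2 : E → ℝ) (L : ℝ) (hL : 0 ≤ L)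
    (hf2 : ContDiff ℝ 1 f2)
    (hLip : ∀ x y, ‖gradient f2 x - gradient f2 y‖ ≤ L * ‖x - y‖)
    (C : Set E) (hCne : C.Nonempty) (hCclosed : IsClosed C)
    (hf1 : LowerSemicontinuous f1)
    (hbdd : ∃ m : ℝ, ∀ z ∈ C, m ≤ f1 z)
    (τ : ℝ) (hτ : 0 < τ) (x : E) (hx : x ∈ C) (xp : E) (hxp : xp ∈ C)
    (hmin : ∀ z ∈ C,
      f1 xp + (1 / (2 * τ)) * ‖xp - (x - τ • gradient f2 x)‖ ^ 2
        ≤ f1 z + (1 / (2 * τ)) * ‖z - (x - τ • gradient f2 x)‖ ^ 2) :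
    (1 / 2) * (1 / τ - L) * ‖xp - x‖ ^ 2
      ≤ (f1 x + f2 x) - (f1 xp + f2 xp) := by
  have hmodel := le_add_inner_gradient_add_sq_of_lipschitz
    (hf2.differentiable one_ne_zero) hLip x (xp - x)
  rw [add_sub_cancel] at hmodel
  have hprox := hmin x hx
  have hxp_sub : xp - (x - τ • gradient f2 x) = (xp - x) + τ • gradient f2 x := by abel
  rw [hxp_sub, sub_sub_cancel, norm_add_sq_real, real_inner_smul_right,
    real_inner_comm] at hprox
  have hexpand : 1 / (2 * τ) * (‖xp - x‖ ^ 2 + 2 * (τ * inner ℝ (gradient f2 x) (xp - x))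
        + ‖τ • gradient f2 x‖ ^ 2)
      = 1 / 2 * (1 / τ) * ‖xp - x‖ ^ 2 + inner ℝ (gradient f2 x) (xp - x)
        + 1 / (2 * τ) * ‖τ • gradient f2 x‖ ^ 2 := by
    field_simp
  linarith
end
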